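/- arXiv:1608.00673 — 11 statements merged into one kernel-verified Lean document; each statement's English description precedes it below -/
import Mathlib

section
/- Let n be a natural number and let a : Fin n → ℝ satisfy 0 ≤ a i ≤ 1 for every i, and set b i = 1 − a i. Then ∑_{i} a i · (∏_{j < i} b j)^2 ≥ (1/2) · ∑_{i} a i · ∏_{j < i} b j, where sums and products range over indices in Fin n. -/
theorem stem_inequality (n : ℕ) (a : Fin n → ℝ) (ha : ∀ i, 0 ≤ a i ∧ a i ≤ 1)
    (b : Fin n → ℝ) (hb : ∀ i, b i = 1 - a i) :
    ∑ i : Fin n, a i * (∏ j ∈ Finset.univ.filter (fun j => j < i), b j) ^ 2 ≥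
      (1 / 2) * ∑ i : Fin n, a i * ∏ j ∈ Finset.univ.filter (fun j => j < i), b j := by
  have hlin := Finset.prod_one_sub_ordered Finset.univ a
  have hsq := Finset.prod_one_sub_ordered Finset.univ (fun i => 1 - b i ^ 2)
  simp only [← hb, sub_sub_cancel, Finset.prod_pow] at hlin hsq
  have hbound : ∑ i, (1 - b i ^ 2) * (∏ j ∈ Finset.univ.filter (fun j => j < i), b j) ^ 2 ≤
      2 * ∑ i, a i * (∏ j ∈ Finset.univ.filter (fun j => j < i), b j) ^ 2 := by
    rw [Finset.mul_sum]
    refine Finset.sum_le_sum fun i _ => ?_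
    rw [← mul_assoc]
    refine mul_le_mul_of_nonneg_right ?_ (sq_nonneg _)
    nlinarith [hb i, sq_nonneg (a i)]
  have hprod_nonneg : 0 ≤ ∏ i, b i :=
    Finset.prod_nonneg fun i _ => by linarith [hb i, (ha i).2]
  have hprod_le_one : ∏ i, b i ≤ 1 :=
    Finset.prod_le_one (fun i _ => by linarith [hb i, (ha i).2])
      (fun i _ => by linarith [hb i, (ha i).1])
  nlinarith [mul_nonneg hprod_nonneg (sub_nonneg.2 hprod_le_one)]
end

section
/- Let n be a natural number, let p : Fin n → ℝ satisfy 0 ≤ p i ≤ 1 for every i, set q i = 1 − p i, and let W be an arbitrary subset (Finset) of Fin n. Then ∑_{i ∈ W} p i · (∏_{j < i, j ∈ W} (q j)^2) · (∏_{j < i, j ∉ W} q j) ≥ (1/2) · ∑_{i ∈ W} p i · ∏_{j < i} q j. -/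
theorem Finset.filter_insert_lt_and_of_not_lt {ι : Type*} [LinearOrder ι] (s : Finset ι) {m i : ι}
    (h : ¬ m < i) (P : ι → Prop) [DecidablePred P] :
    (insert m s).filter (fun j => j < i ∧ P j) = s.filter (fun j => j < i ∧ P j) := by
  rw [Finset.filter_insert, if_neg (fun h' => h h'.1)]

theorem Finset.filter_insert_lt_and_of_forall_lt {ι : Type*} [LinearOrder ι] {s : Finset ι} {m : ι}
    (h : ∀ x ∈ s, x < m) (P : ι → Prop) [DecidablePred P] :
    (insert m s).filter (fun j => j < m ∧ P j) = s.filter P := by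
  rw [Finset.filter_insert_lt_and_of_not_lt s (lt_irrefl m)]
  exact Finset.filter_congr fun x hx => by simp [h x hx]

/-- Inequality between the stem sums over a finite set, with the slack `b * (a - a ^ 2)`, where `a`
and `b` are the products of `q` inside and outside of `W`. -/
theorem stem_inequality_slack {ι : Type*} [LinearOrder ι] (p q : ι → ℝ)
    (hp : ∀ i, 0 ≤ p i ∧ p i ≤ 1) (hq : ∀ i, q i = 1 - p i) (W s : Finset ι) :
    (∏ j ∈ s.filter (fun j => j ∉ W), q j) *
        ((∏ j ∈ s.filter (fun j => j ∈ W), q j) - (∏ j ∈ s.filter (fun j => j ∈ W), q j) ^ 2) ≤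
      2 * (∑ i ∈ s.filter (fun i => i ∈ W),
        p i * (∏ j ∈ s.filter (fun j => j < i ∧ j ∈ W), (q j) ^ 2) *
          (∏ j ∈ s.filter (fun j => j < i ∧ j ∉ W), q j)) -
      ∑ i ∈ s.filter (fun i => i ∈ W), p i * ∏ j ∈ s.filter (fun j => j < i), q j := by
  have q0 : ∀ i, 0 ≤ q i := fun i => by linarith [hq i, (hp i).2]
  have q1 : ∀ i, q i ≤ 1 := fun i => by linarith [hq i, (hp i).1]
  induction s using Finset.induction_on_max with
  | empty => simp
  | insert m s hm ih =>
    have hms : m ∉ s := fun h => lt_irrefl m (hm m h)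
    have hA : ∑ i ∈ s.filter (fun i => i ∈ W),
        p i * (∏ j ∈ (insert m s).filter (fun j => j < i ∧ j ∈ W), (q j) ^ 2) *
          (∏ j ∈ (insert m s).filter (fun j => j < i ∧ j ∉ W), q j) =
        ∑ i ∈ s.filter (fun i => i ∈ W),
        p i * (∏ j ∈ s.filter (fun j => j < i ∧ j ∈ W), (q j) ^ 2) *
          (∏ j ∈ s.filter (fun j => j < i ∧ j ∉ W), q j) := by
      refine Finset.sum_congr rfl fun i hi => ?_
      have h := (hm i (Finset.mem_filter.1 hi).1).not_gt
      rw [Finset.filter_insert_lt_and_of_not_lt s h, Finset.filter_insert_lt_and_of_not_lt s h]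
    have hB : ∑ i ∈ s.filter (fun i => i ∈ W),
        p i * ∏ j ∈ (insert m s).filter (fun j => j < i), q j =
        ∑ i ∈ s.filter (fun i => i ∈ W), p i * ∏ j ∈ s.filter (fun j => j < i), q j := by
      refine Finset.sum_congr rfl fun i hi => ?_
      rw [Finset.filter_insert, if_neg (hm i (Finset.mem_filter.1 hi).1).not_gt]
    have ha0 : 0 ≤ ∏ j ∈ s.filter (fun j => j ∈ W), q j := Finset.prod_nonneg fun i _ => q0 i
    have ha1 : ∏ j ∈ s.filter (fun j => j ∈ W), q j ≤ 1 :=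
      Finset.prod_le_one (fun i _ => q0 i) fun i _ => q1 i
    have hb0 : 0 ≤ ∏ j ∈ s.filter (fun j => j ∉ W), q j := Finset.prod_nonneg fun i _ => q0 i
    by_cases hW : m ∈ W
    · have hmax : (insert m s).filter (fun j => j < m) = s := by
        rw [Finset.filter_insert, if_neg (lt_irrefl m), Finset.filter_true_of_mem hm]
      rw [Finset.filter_insert (fun j => j ∈ W), if_pos hW,
        Finset.filter_insert (fun j => j ∉ W), if_neg (not_not.2 hW),
        Finset.sum_insert (by simp [hms]), Finset.sum_insert (by simp [hms]),
        Finset.prod_insert (by simp [hms]), hA, hB,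
        Finset.filter_insert_lt_and_of_forall_lt hm, Finset.filter_insert_lt_and_of_forall_lt hm,
        hmax, Finset.prod_pow, ← Finset.prod_filter_mul_prod_filter_not s (fun j => j ∈ W) q, hq m]
      set a := ∏ j ∈ s.filter (fun j => j ∈ W), q j
      set b := ∏ j ∈ s.filter (fun j => j ∉ W), q j
      have : 0 ≤ b * (a * p m) ^ 2 := by positivity
      linarith
    · rw [Finset.filter_insert (fun j => j ∈ W), if_neg hW,
        Finset.filter_insert (fun j => j ∉ W), if_pos hW, Finset.prod_insert (by simp [hms]),
        hA, hB]
      refine le_trans (mul_le_mul_of_nonneg_right (mul_le_of_le_one_left hb0 (q1 m)) ?_) ih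
      nlinarith

theorem stem_inequality_subset (n : ℕ) (p : Fin n → ℝ) (hp : ∀ i, 0 ≤ p i ∧ p i ≤ 1)
    (q : Fin n → ℝ) (hq : ∀ i, q i = 1 - p i) (W : Finset (Fin n)) :
    ∑ i ∈ W, p i * (∏ j ∈ Finset.univ.filter (fun j => j < i ∧ j ∈ W), (q j) ^ 2) *
        (∏ j ∈ Finset.univ.filter (fun j => j < i ∧ j ∉ W), q j) ≥
      (1 / 2) * ∑ i ∈ W, p i * ∏ j ∈ Finset.univ.filter (fun j => j < i), q j := by
  have q0 : ∀ i, 0 ≤ q i := fun i => by linarith [hq i, (hp i).2]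
  have q1 : ∀ i, q i ≤ 1 := fun i => by linarith [hq i, (hp i).1]
  have h := stem_inequality_slack p q hp hq W Finset.univ
  have ha0 : 0 ≤ ∏ j ∈ Finset.univ.filter (fun j => j ∈ W), q j :=
    Finset.prod_nonneg fun i _ => q0 i
  have ha1 : ∏ j ∈ Finset.univ.filter (fun j => j ∈ W), q j ≤ 1 :=
    Finset.prod_le_one (fun i _ => q0 i) fun i _ => q1 i
  have hb0 : 0 ≤ ∏ j ∈ Finset.univ.filter (fun j => j ∉ W), q j :=
    Finset.prod_nonneg fun i _ => q0 i
  have h0 := (mul_nonneg hb0 (sub_nonneg.2 (pow_le_of_le_one ha0 ha1 two_ne_zero))).trans h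
  rw [Finset.filter_univ_mem] at h0
  linarith
end

section
/- Let n be a natural number and let a : Fin n → ℝ satisfy 0 ≤ a i ≤ 1 for every i, and set b i = 1 − a i. Then ∑_{i} a i · (∏_{j < i} b j)^2 ≥ (1/2) · (1 − ∏_{i} (b i)^2). -/
theorem stem_inequality_squared_product (n : ℕ) (a : Fin n → ℝ)
    (ha : ∀ i, 0 ≤ a i ∧ a i ≤ 1) (b : Fin n → ℝ) (hb : ∀ i, b i = 1 - a i) :
    ∑ i : Fin n, a i * (∏ j ∈ Finset.univ.filter (fun j => j < i), b j) ^ 2 ≥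
      (1 / 2) * (1 - ∏ i : Fin n, (b i) ^ 2) := by
  have telescope := Finset.prod_one_sub_ordered Finset.univ (fun i => 1 - b i ^ 2)
  simp only [sub_sub_cancel] at telescope
  rw [telescope, sub_sub_cancel, Finset.mul_sum, ge_iff_le]
  refine Finset.sum_le_sum fun i _ => ?_
  rw [Finset.prod_pow, ← mul_assoc]
  gcongr
  rw [hb]
  nlinarith [sq_nonneg (a i)]
end

section
/- Let X be a finite type and let f : Finset X → ℝ be nonnegative and submodular. For a finset S, define f^max(S) to be the maximum of f T over all finsets T ⊆ S. Then (1/4) · f^max(S) ≤ (1/2^{|S|}) · ∑_{R ⊆ S} f R ≤ f^max(S); that is, the average of f over all subsets of S (equivalently, the expectation of f on a uniformly random subset of S obtained by keeping each element independently with probability 1/2) is at least a quarter of the maximum value of f on subsets of S, and at most that maximum. -/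
theorem Finset.sum_powerset_symmDiff {X M : Type*} [DecidableEq X] [AddCommMonoid M]
    (f : Finset X → M) {S T : Finset X} (hT : T ⊆ S) :
    ∑ R ∈ S.powerset, f (symmDiff R T) = ∑ R ∈ S.powerset, f R := by
  have maps_to : ∀ R ∈ S.powerset, symmDiff R T ∈ S.powerset := by
    intro R hR
    rw [Finset.mem_powerset] at hR ⊢
    intro x hx
    rw [Finset.mem_symmDiff] at hx
    rcases hx with hx | hx
    · exact hR hx.1
    · exact hT hx.1
  exact Finset.sum_nbij' (fun R => symmDiff R T) (fun R => symmDiff R T) maps_to maps_to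
    (fun R _ => symmDiff_symmDiff_cancel_right T R)
    (fun R _ => symmDiff_symmDiff_cancel_right T R) (fun _ _ => rfl)

theorem le_add_symmDiff_of_submodular {X : Type*} [DecidableEq X]
    (f : Finset X → ℝ) (hnonneg : ∀ S, 0 ≤ f S)
    (hsub : ∀ A B, f (A ∪ B) + f (A ∩ B) ≤ f A + f B) (R T : Finset X) :
    f (R ∪ T) ≤ f R + f (symmDiff R T) := by
  have h := hsub R (symmDiff R T)
  have hu : R ∪ symmDiff R T = R ∪ T := by
    ext x
    simp only [Finset.mem_union, Finset.mem_symmDiff]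
    tauto
  rw [hu] at h
  linarith [hnonneg (R ∩ symmDiff R T)]

theorem le_four_symmDiff_of_submodular {X : Type*} [DecidableEq X]
    (f : Finset X → ℝ) (hnonneg : ∀ S, 0 ≤ f S)
    (hsub : ∀ A B, f (A ∪ B) + f (A ∩ B) ≤ f A + f B) {R S T : Finset X}
    (hR : R ⊆ S) :
    f T ≤ f R + f (symmDiff R T) +
      (f (symmDiff R S) + f (symmDiff (symmDiff R S) T)) := by
  have h₁ := le_add_symmDiff_of_submodular f hnonneg hsub R T
  have h₂ := le_add_symmDiff_of_submodular f hnonneg hsub (symmDiff R S) T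
  have h₃ := hsub (R ∪ T) (symmDiff R S ∪ T)
  have hi : (R ∪ T) ∩ (symmDiff R S ∪ T) = T := by
    ext x
    have := @hR x
    simp only [Finset.mem_union, Finset.mem_inter, Finset.mem_symmDiff]
    tauto
  rw [hi] at h₃
  linarith [hnonneg ((R ∪ T) ∪ (symmDiff R S ∪ T))]

theorem average_vs_max_submodular {X : Type*} [Fintype X] [DecidableEq X]
    (f : Finset X → ℝ) (hnonneg : ∀ S, 0 ≤ f S)
    (hsub : ∀ A B, f (A ∪ B) + f (A ∩ B) ≤ f A + f B) (S : Finset X) :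
    (1 / 4) * (S.powerset.sup' ⟨∅, Finset.empty_mem_powerset S⟩ f) ≤
        (1 / 2 ^ S.card) * ∑ R ∈ S.powerset, f R ∧
      (1 / 2 ^ S.card) * ∑ R ∈ S.powerset, f R ≤
        S.powerset.sup' ⟨∅, Finset.empty_mem_powerset S⟩ f := by
  have hpos : (0 : ℝ) < 2 ^ S.card := by positivity
  rw [one_div_mul_eq_div, one_div_mul_eq_div, le_div_iff₀ hpos, div_le_iff₀ hpos]
  constructor
  · obtain ⟨T, hT, hmax⟩ :=
      Finset.exists_mem_eq_sup' ⟨∅, Finset.empty_mem_powerset S⟩ f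
    rw [hmax]
    rw [Finset.mem_powerset] at hT
    have h := Finset.sum_le_sum fun R (hR : R ∈ S.powerset) =>
      le_four_symmDiff_of_submodular f hnonneg hsub (T := T) (Finset.mem_powerset.mp hR)
    simp only [Finset.sum_add_distrib, Finset.sum_const, Finset.card_powerset,
      nsmul_eq_mul, Nat.cast_pow, Nat.cast_ofNat] at h
    rw [Finset.sum_powerset_symmDiff (fun R => f (symmDiff R T)) (Finset.Subset.refl S),
      Finset.sum_powerset_symmDiff f (Finset.Subset.refl S),
      Finset.sum_powerset_symmDiff f hT] at h
    linarith
  · have h := Finset.sum_le_card_nsmul S.powerset f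
      (S.powerset.sup' ⟨∅, Finset.empty_mem_powerset S⟩ f) fun R hR => Finset.le_sup' f hR
    rw [Finset.card_powerset, nsmul_eq_mul, Nat.cast_pow, Nat.cast_ofNat] at h
    linarith
end

section
/- Let A be a finite type, let h : Finset A → ℝ be nonnegative and submodular (h(∅) need not be 0), and let p ∈ [0,1]. Let w : Finset A → ℝ be nonnegative weights with ∑_{S} w S = 1 (a probability distribution over finsets of A, not necessarily a product distribution), and suppose that for every element e of A, ∑_{S : e ∈ S} w S ≤ p (each element is included with probability at most p). Then ∑_{S} w S · h S ≥ (1 − p) · h(∅). -/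
/-- Intersecting with `insert a U` rather than `U` changes a submodular function by at least its
marginal value of `a` at `U`, provided `a ∈ S`. -/
theorem submodular_inter_insert {A : Type*} [DecidableEq A] (h : Finset A → ℝ)
    (hsub : ∀ S T, h (S ∪ T) + h (S ∩ T) ≤ h S + h T)
    (a : A) (U S : Finset A) (ha : a ∉ U) :
    h (S ∩ U) + (if a ∈ S then h (insert a U) - h U else 0) ≤ h (S ∩ insert a U) := by
  split_ifs with haS
  · have key := hsub (S ∩ insert a U) U
    have hunion : S ∩ insert a U ∪ U = insert a U := by grind
    have hinter : S ∩ insert a U ∩ U = S ∩ U := by grind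
    rw [hunion, hinter] at key
    linarith
  · rw [Finset.inter_insert_of_notMem haS, add_zero]

/-- If `q` is a lower bound for the marginals of the elements of `U`, and `p` an upper bound for
all marginals, then the expectation of `h (S ∩ U)` is at least `(1 - p) * h ∅ + q * h U`. -/
theorem le_sum_mul_submodular_inter {A : Type*} [Fintype A] [DecidableEq A]
    (h : Finset A → ℝ) (hnonneg : ∀ S, 0 ≤ h S)
    (hsub : ∀ S T, h (S ∪ T) + h (S ∩ T) ≤ h S + h T)
    (p : ℝ) (w : Finset A → ℝ) (hw0 : ∀ S, 0 ≤ w S) (hw1 : ∑ S : Finset A, w S = 1)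
    (hmarg : ∀ e : A, ∑ S ∈ Finset.univ.filter (fun S => e ∈ S), w S ≤ p) (U : Finset A) :
    ∀ q ≤ p, (∀ e ∈ U, q ≤ ∑ S ∈ Finset.univ.filter (fun S => e ∈ S), w S) →
      (1 - p) * h ∅ + q * h U ≤ ∑ S : Finset A, w S * h (S ∩ U) := by
  induction U using Finset.induction_on_min_value
    (fun e => ∑ S ∈ Finset.univ.filter (fun S => e ∈ S), w S) with
  | empty =>
    intro q hq _
    simp only [Finset.inter_empty, ← Finset.sum_mul, hw1]
    nlinarith [hnonneg ∅]
  | insert a U ha hmin ih =>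
    intro q _ hqU
    set x := ∑ S ∈ Finset.univ.filter (fun S => a ∈ S), w S with hx
    have hU := ih x (hmarg a) hmin
    have hqx : q * h (insert a U) ≤ x * h (insert a U) :=
      mul_le_mul_of_nonneg_right (hqU a (Finset.mem_insert_self a U)) (hnonneg _)
    have hsum : ∑ S : Finset A, w S * h (S ∩ U) + x * (h (insert a U) - h U) ≤
        ∑ S : Finset A, w S * h (S ∩ insert a U) := by
      rw [hx, Finset.sum_mul, Finset.sum_filter, ← Finset.sum_add_distrib]
      refine Finset.sum_le_sum fun S _ => ?_
      have hS := mul_le_mul_of_nonneg_left (submodular_inter_insert h hsub a U S ha) (hw0 S)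
      rwa [mul_add, mul_ite, mul_zero] at hS
    linarith

theorem sampling_lemma {A : Type*} [Fintype A] [DecidableEq A]
    (h : Finset A → ℝ) (hnonneg : ∀ S, 0 ≤ h S)
    (hsub : ∀ S T, h (S ∪ T) + h (S ∩ T) ≤ h S + h T)
    (p : ℝ) (hp0 : 0 ≤ p) (hp1 : p ≤ 1)
    (w : Finset A → ℝ) (hw0 : ∀ S, 0 ≤ w S) (hw1 : ∑ S : Finset A, w S = 1)
    (hmarg : ∀ e : A, ∑ S ∈ Finset.univ.filter (fun S => e ∈ S), w S ≤ p) :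
    ∑ S : Finset A, w S * h S ≥ (1 - p) * h ∅ := by
  simpa using le_sum_mul_submodular_inter h hnonneg hsub p w hw0 hw1 hmarg Finset.univ 0 hp0
    fun e _ => Finset.sum_nonneg fun S _ => hw0 S
end

section
/- Let I be a finite index set and let x : I → ℝ satisfy 0 ≤ x i ≤ 1 for every i ∈ I. Then 1 − ∏_{i ∈ I} (1 − x i) ≥ (1 − 1/e) · min( ∑_{i ∈ I} x i , 1 ), where e is Euler's number. -/
theorem exp_neg_le_one_sub_mul {t : ℝ} (h0 : 0 ≤ t) (h1 : t ≤ 1) :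
    Real.exp (-t) ≤ 1 - (1 - 1 / Real.exp 1) * t := by
  have h := convexOn_exp.2 (Set.mem_univ (0 : ℝ)) (Set.mem_univ (-1 : ℝ))
    (sub_nonneg.2 h1) h0 (by ring)
  simp only [smul_eq_mul, mul_zero, zero_add, mul_neg, mul_one, Real.exp_zero] at h
  rw [Real.exp_neg 1] at h
  rw [one_div]
  linarith

theorem prod_one_sub_le_exp_neg_sum {ι : Type*} (I : Finset ι) (x : ι → ℝ)
    (hx : ∀ i ∈ I, x i ≤ 1) :
    ∏ i ∈ I, (1 - x i) ≤ Real.exp (-∑ i ∈ I, x i) := by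
  rw [← Finset.sum_neg_distrib, Real.exp_sum]
  exact Finset.prod_le_prod (fun i hi => sub_nonneg.2 (hx i hi))
    fun i _ => Real.one_sub_le_exp_neg (x i)

theorem one_sub_prod_ge {ι : Type*} (I : Finset ι) (x : ι → ℝ)
    (hx : ∀ i ∈ I, 0 ≤ x i ∧ x i ≤ 1) :
    1 - ∏ i ∈ I, (1 - x i) ≥ (1 - 1 / Real.exp 1) * min (∑ i ∈ I, x i) 1 := by
  have hprod := prod_one_sub_le_exp_neg_sum I x fun i hi => (hx i hi).2
  have hexp : Real.exp (-∑ i ∈ I, x i) ≤ Real.exp (-min (∑ i ∈ I, x i) 1) :=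
    Real.exp_le_exp.2 (neg_le_neg (min_le_left _ _))
  have hchord := exp_neg_le_one_sub_mul
    (le_min (Finset.sum_nonneg fun i hi => (hx i hi).1) zero_le_one)
    (min_le_right (∑ i ∈ I, x i) 1)
  linarith
end

section
/- Let X be a finite type and let f : Finset X → ℝ be fractionally subadditive. Define f^max : Finset X → ℝ by f^max(T) = max_{U ⊆ T} f(U). Then f^max is fractionally subadditive: for every finset T, every natural number m, every α : Fin m → ℝ with α i ≥ 0, and every family of finsets S : Fin m → Finset X such that for every element e of X, ∑_{i : e ∈ S i} α i equals 1 if e ∈ T and equals 0 if e ∉ T, one has f^max(T) ≤ ∑_{i} α i · f^max(S i). -/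
def FractionallySubadditive {X : Type*} [Fintype X] [DecidableEq X]
    (f : Finset X → ℝ) : Prop :=
  ∀ (T : Finset X) (m : ℕ) (α : Fin m → ℝ), (∀ i, 0 ≤ α i) →
    ∀ S : Fin m → Finset X,
      (∀ e : X, ∑ i ∈ Finset.univ.filter (fun i => e ∈ S i), α i
          = if e ∈ T then (1 : ℝ) else 0) →
      f T ≤ ∑ i : Fin m, α i * f (S i)

theorem fmax_fractionally_subadditive {X : Type*} [Fintype X] [DecidableEq X]
    (f : Finset X → ℝ) (hf : FractionallySubadditive f) :
    FractionallySubadditive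
      (fun T => T.powerset.sup' ⟨∅, Finset.empty_mem_powerset T⟩ f) := by
  intro T m α hα S hS
  refine Finset.sup'_le _ _ fun U hU => ?_
  have hUT : U ⊆ T := Finset.mem_powerset.mp hU
  refine (hf U m α hα (fun i => S i ∩ U) fun e => ?_).trans ?_
  · by_cases he : e ∈ U
    · simpa [he, hUT he] using hS e
    · simp [he]
  · exact Finset.sum_le_sum fun i _ => mul_le_mul_of_nonneg_left
      (Finset.le_sup' f (Finset.mem_powerset.mpr Finset.inter_subset_left)) (hα i)
end

section
/- Let X be a finite type and let f : Finset X → ℝ be fractionally subadditive and monotone (f S ≤ f T whenever S ⊆ T). Then f satisfies the fractional covering property: for every finset T, every natural number m, every α : Fin m → ℝ with α i ≥ 0, and every family of finsets S : Fin m → Finset X such that for every element e ∈ T one has ∑_{i : e ∈ S i} α i ≥ 1, it holds that f(T) ≤ ∑_{i} α i · f(S i). -/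
/-- The inequality defining fractional subadditivity holds for families over any finite type. -/
theorem FractionallySubadditive.le_sum {X ι : Type*} [Fintype X] [DecidableEq X] [Fintype ι]
    {f : Finset X → ℝ} (hf : FractionallySubadditive f) (T : Finset X) (α : ι → ℝ)
    (hα : ∀ i, 0 ≤ α i) (S : ι → Finset X)
    (hS : ∀ e : X, ∑ i, (if e ∈ S i then α i else 0) = if e ∈ T then (1 : ℝ) else 0) :
    f T ≤ ∑ i, α i * f (S i) := by
  let φ := (Fintype.equivFin ι).symm
  rw [← φ.sum_comp]
  refine hf T _ (fun j => α (φ j)) (fun j => hα _) (fun j => S (φ j)) fun e => ?_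
  rw [Finset.sum_filter, ← hS e]
  exact φ.sum_comp fun i => if e ∈ S i then α i else 0

/-- The probability that independent choices, including each `e` with probability `p e`,
produce exactly the set `R`. -/
def independentWeight {X : Type*} [Fintype X] [DecidableEq X] (p : X → ℝ) (R : Finset X) : ℝ :=
  (∏ e ∈ R, p e) * ∏ e ∈ Rᶜ, (1 - p e)

theorem independentWeight_nonneg {X : Type*} [Fintype X] [DecidableEq X] {p : X → ℝ}
    (hp₀ : ∀ e, 0 ≤ p e) (hp₁ : ∀ e, p e ≤ 1) (R : Finset X) : 0 ≤ independentWeight p R :=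
  mul_nonneg (Finset.prod_nonneg fun e _ => hp₀ e)
    (Finset.prod_nonneg fun e _ => sub_nonneg.2 (hp₁ e))

theorem sum_independentWeight {X : Type*} [Fintype X] [DecidableEq X] (p : X → ℝ) :
    ∑ R, independentWeight p R = 1 := by
  have h := Fintype.prod_add p fun e => 1 - p e
  simpa [independentWeight] using h.symm

theorem sum_independentWeight_mem {X : Type*} [Fintype X] [DecidableEq X] (p : X → ℝ) (e : X) :
    ∑ R, (if e ∈ R then independentWeight p R else 0) = p e := by
  have h := Fintype.prod_add p fun x => if x = e then 0 else 1 - p x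
  have hprod : ∏ x, (p x + if x = e then 0 else 1 - p x) = p e := by
    rw [Fintype.prod_eq_single e fun x hx => by simp [hx]]
    simp
  rw [← hprod, h]
  refine Finset.sum_congr rfl fun R _ => ?_
  split_ifs with he
  · refine congrArg _ (Finset.prod_congr rfl fun x hx => ?_)
    have hxe : x ≠ e := by
      rintro rfl
      exact Finset.mem_compl.1 hx he
    simp [hxe]
  · rw [Finset.prod_eq_zero (Finset.mem_compl.2 he) (by simp), mul_zero]

theorem monotone_xos_fractional_cover {X : Type*} [Fintype X] [DecidableEq X]
    (f : Finset X → ℝ) (hf : FractionallySubadditive f)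
    (hmono : ∀ S T : Finset X, S ⊆ T → f S ≤ f T) :
    ∀ (T : Finset X) (m : ℕ) (α : Fin m → ℝ), (∀ i, 0 ≤ α i) →
      ∀ S : Fin m → Finset X,
        (∀ e ∈ T, (1 : ℝ) ≤ ∑ i ∈ Finset.univ.filter (fun i => e ∈ S i), α i) →
        f T ≤ ∑ i : Fin m, α i * f (S i) := by
  intro T m α hα S hcov
  let c : X → ℝ := fun e => ∑ i ∈ Finset.univ.filter (fun i => e ∈ S i), α i
  let p : X → ℝ := fun e => if e ∈ T then (c e)⁻¹ else 0
  have hp₀ : ∀ e, 0 ≤ p e := fun e => by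
    have : 0 ≤ c e := Finset.sum_nonneg fun i _ => hα i
    dsimp only [p]
    split_ifs <;> positivity
  have hp₁ : ∀ e, p e ≤ 1 := fun e => by
    dsimp only [p]
    split_ifs with he
    · exact inv_le_one_of_one_le₀ (hcov e he)
    · exact zero_le_one
  have hw := independentWeight_nonneg hp₀ hp₁
  have hexact : ∀ e : X,
      ∑ q : Fin m × Finset X,
        (if e ∈ S q.1 ∩ q.2 then α q.1 * independentWeight p q.2 else 0) =
      if e ∈ T then (1 : ℝ) else 0 := fun e => by
    calc _ = ∑ i, ∑ R, (if e ∈ S i then α i else 0) *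
          (if e ∈ R then independentWeight p R else 0) := by
          rw [Fintype.sum_prod_type]
          simp only [Finset.mem_inter, ite_and, ite_mul, mul_ite, mul_zero, zero_mul]
          refine Finset.sum_congr rfl fun i _ => Finset.sum_congr rfl fun R _ => ?_
          split_ifs <;> rfl
      _ = c e * p e := by
          rw [← Finset.sum_mul_sum, sum_independentWeight_mem, ← Finset.sum_filter]
      _ = _ := by
          dsimp only [p]
          split_ifs with he
          · exact mul_inv_cancel₀ (zero_lt_one.trans_le (hcov e he)).ne'
          · exact mul_zero _
  calc f T ≤ ∑ q : Fin m × Finset X, α q.1 * independentWeight p q.2 * f (S q.1 ∩ q.2) :=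
        hf.le_sum T _ (fun q => mul_nonneg (hα _) (hw _)) _ hexact
    _ ≤ ∑ q : Fin m × Finset X, α q.1 * independentWeight p q.2 * f (S q.1) :=
        Finset.sum_le_sum fun q _ => mul_le_mul_of_nonneg_left
          (hmono _ _ Finset.inter_subset_left) (mul_nonneg (hα _) (hw _))
    _ = ∑ i, α i * f (S i) := by
        rw [Fintype.sum_prod_type]
        refine Finset.sum_congr rfl fun i _ => ?_
        dsimp only
        rw [← Finset.sum_mul, ← Finset.mul_sum, sum_independentWeight, mul_one]
end

section
/- Let X be a finite type, let p : X → ℝ satisfy 0 ≤ p e ≤ 1 for every e, and let f : Finset X → ℝ be monotone (f S ≤ f T whenever S ⊆ T) and submodular. Define g : Finset X → ℝ by g(S) = ∑_{A ⊆ X} (∏_{e ∈ A} p e) · (∏_{e ∉ A} (1 − p e)) · f(S ∩ A), i.e., g(S) is the expectation of f(S ∩ A) where A contains each element e of X independently with probability p e. Then g is monotone and submodular. -/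
theorem expected_value_monotone_submodular {X : Type*} [Fintype X] [DecidableEq X]
    (p : X → ℝ) (hp : ∀ e, 0 ≤ p e ∧ p e ≤ 1)
    (f : Finset X → ℝ) (hmono : ∀ S T : Finset X, S ⊆ T → f S ≤ f T)
    (hsub : ∀ A B : Finset X, f (A ∪ B) + f (A ∩ B) ≤ f A + f B)
    (g : Finset X → ℝ)
    (hg : ∀ S : Finset X, g S = ∑ A : Finset X,
      (∏ e ∈ A, p e) * (∏ e ∈ Finset.univ \ A, (1 - p e)) * f (S ∩ A)) :
    (∀ S T : Finset X, S ⊆ T → g S ≤ g T) ∧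
      (∀ A B : Finset X, g (A ∪ B) + g (A ∩ B) ≤ g A + g B) := by
  have hw (A : Finset X) : 0 ≤ (∏ e ∈ A, p e) * (∏ e ∈ Finset.univ \ A, (1 - p e)) :=
    mul_nonneg (Finset.prod_nonneg fun e _ => (hp e).1)
      (Finset.prod_nonneg fun e _ => sub_nonneg.mpr (hp e).2)
  refine ⟨fun S T hST => ?_, fun A B => ?_⟩
  · rw [hg, hg]
    exact Finset.sum_le_sum fun C _ => mul_le_mul_of_nonneg_left
      (hmono _ _ (Finset.inter_subset_inter_right hST)) (hw C)
  · simp only [hg, ← Finset.sum_add_distrib, ← mul_add]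
    refine Finset.sum_le_sum fun C _ => mul_le_mul_of_nonneg_left ?_ (hw C)
    rw [Finset.union_inter_distrib_right, Finset.inter_inter_distrib_right]
    exact hsub _ _
end

section
/- Let X be a finite type, let W be a positive natural number, and let a : Fin W → X → ℝ satisfy a i e ≥ 0 for all i and e. Define f : Finset X → ℝ by f(S) = max_{i ∈ Fin W} ∑_{e ∈ S} a i e. Then f is fractionally subadditive: for every finset T, every natural number m, every α : Fin m → ℝ with α j ≥ 0, and every family of finsets S : Fin m → Finset X such that for every element e of X, ∑_{j : e ∈ S j} α j equals 1 if e ∈ T and equals 0 if e ∉ T, one has f(T) ≤ ∑_{j} α j · f(S j). -/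
/-- If the weights `α` on the sets `S j` form an exact fractional cover of `T`, then every additive
function takes the same value on `T` as on the weighted family. -/
theorem sum_eq_sum_mul_sum_of_exact_fractional_cover {X ι : Type*} [Fintype X] [DecidableEq X]
    [Fintype ι] (b : X → ℝ) (T : Finset X) (α : ι → ℝ) (S : ι → Finset X)
    (hS : ∀ e : X, ∑ j ∈ Finset.univ.filter (fun j => e ∈ S j), α j
      = if e ∈ T then (1 : ℝ) else 0) :
    ∑ e ∈ T, b e = ∑ j, α j * ∑ e ∈ S j, b e := by
  calc ∑ e ∈ T, b e = ∑ e, (if e ∈ T then (1 : ℝ) else 0) * b e := by simp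
    _ = ∑ e, ∑ j, if e ∈ S j then α j * b e else 0 := by
        refine Finset.sum_congr rfl fun e _ => ?_
        rw [← hS e, Finset.sum_mul, Finset.sum_filter]
    _ = ∑ j, ∑ e, if e ∈ S j then α j * b e else 0 := Finset.sum_comm
    _ = ∑ j, α j * ∑ e ∈ S j, b e := by simp [Finset.mul_sum]

theorem width_W_xos_is_fractionally_subadditive {X : Type*} [Fintype X] [DecidableEq X]
    (W : ℕ) (hW : 0 < W) (a : Fin W → X → ℝ) (ha : ∀ i e, 0 ≤ a i e)
    (f : Finset X → ℝ)
    (hf : ∀ S : Finset X,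
      f S = (Finset.univ : Finset (Fin W)).sup'
        ⟨⟨0, hW⟩, Finset.mem_univ _⟩ (fun i => ∑ e ∈ S, a i e)) :
    ∀ (T : Finset X) (m : ℕ) (α : Fin m → ℝ), (∀ j, 0 ≤ α j) →
      ∀ S : Fin m → Finset X,
        (∀ e : X, ∑ j ∈ Finset.univ.filter (fun j => e ∈ S j), α j
            = if e ∈ T then (1 : ℝ) else 0) →
        f T ≤ ∑ j : Fin m, α j * f (S j) := by
  intro T m α hα S hS
  rw [hf T]
  refine Finset.sup'_le _ _ fun i _ => ?_
  rw [sum_eq_sum_mul_sum_of_exact_fractional_cover (a i) T α S hS]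
  refine Finset.sum_le_sum fun j _ => mul_le_mul_of_nonneg_left ?_ (hα j)
  rw [hf (S j)]
  exact Finset.le_sup' (fun i => ∑ e ∈ S j, a i e) (Finset.mem_univ i)
end

section
/- (Freedman's inequality.) Let (Ω, 𝒜, μ) be a probability space with a filtration (ℱ_t)_{t ∈ ℕ}, and let X_1, …, X_n be real random variables such that each X_t is ℱ_t-measurable, the conditional expectation E[X_t ∣ ℱ_{t−1}] = 0 almost surely, and |X_t| ≤ M almost surely for a constant M > 0. For t ≤ n let S_t = ∑_{j=1}^t X_j and W_t = ∑_{j=1}^t E[X_j² ∣ ℱ_{j−1}]. Then for every ℓ ≥ 0 and every σ² > 0, μ( ∃ t ≤ n such that |S_t| ≥ ℓ and W_t ≤ σ² ) ≤ 2 · exp( −(ℓ²/2) / (σ² + M·ℓ/3) ). -/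
open MeasureTheory

/-- The exponential estimate behind Bernstein's and Freedman's inequalities. -/
lemma exp_le_one_add_add_sq_div {b y : ℝ} (hb : b < 3) (hy : |y| ≤ b) :
    Real.exp y ≤ 1 + y + y ^ 2 / (2 * (1 - b / 3)) := by
  have hy3 : |y| / 3 < 1 := by linarith
  have hexp : HasSum (fun k : ℕ => y ^ k / (k.factorial : ℝ)) (Real.exp y) := by
    rw [Real.exp_eq_exp_ℝ]
    exact NormedSpace.expSeries_div_hasSum_exp y
  have htail : HasSum (fun k : ℕ => y ^ (k + 2) / ((k + 2).factorial : ℝ))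
      (Real.exp y - (1 + y)) := by
    simpa [Finset.sum_range_succ] using (hasSum_nat_add_iff' 2).mpr hexp
  have hgeom : HasSum (fun k : ℕ => y ^ 2 / 2 * (|y| / 3) ^ k) (y ^ 2 / 2 * (1 - |y| / 3)⁻¹) :=
    (hasSum_geometric_of_lt_one (by positivity) hy3).mul_left _
  have hle : ∀ k : ℕ, y ^ (k + 2) / ((k + 2).factorial : ℝ) ≤ y ^ 2 / 2 * (|y| / 3) ^ k := by
    intro k
    have hfac : (2 : ℝ) * 3 ^ k ≤ ((k + 2).factorial : ℝ) := by
      have h := Nat.factorial_mul_pow_le_factorial (m := 2) (n := k)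
      rw [add_comm 2 k] at h
      exact_mod_cast h
    calc y ^ (k + 2) / ((k + 2).factorial : ℝ)
        ≤ |y| ^ (k + 2) / ((k + 2).factorial : ℝ) := by
          gcongr ?_ / _
          exact (le_abs_self _).trans_eq (abs_pow _ _)
      _ ≤ |y| ^ (k + 2) / (2 * 3 ^ k) := by gcongr
      _ = y ^ 2 / 2 * (|y| / 3) ^ k := by
          rw [pow_add, sq_abs, div_pow]
          field_simp
  have h := hasSum_le hle htail hgeom
  have hmono : y ^ 2 / 2 * (1 - |y| / 3)⁻¹ ≤ y ^ 2 / (2 * (1 - b / 3)) := by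
    rw [← div_div, div_eq_mul_inv (y ^ 2 / 2)]
    gcongr
    linarith
  linarith

lemma integrable_exp_mul_of_ae_abs_le {Ω : Type*} {m0 : MeasurableSpace Ω} {μ : Measure Ω}
    [IsFiniteMeasure μ] {X : Ω → ℝ} {M θ : ℝ} (hX : AEStronglyMeasurable X μ)
    (hbdd : ∀ᵐ ω ∂μ, |X ω| ≤ M) (hθ : 0 ≤ θ) :
    Integrable (fun ω => Real.exp (θ * X ω)) μ := by
  refine .of_bound (Real.continuous_exp.comp_aestronglyMeasurable (hX.const_mul θ))
    (Real.exp (θ * M)) ?_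
  filter_upwards [hbdd] with ω hω
  rw [Real.norm_eq_abs, Real.abs_exp]
  gcongr
  exact (le_abs_self _).trans hω

/-- Bernstein's bound for the conditional moment generating function of a bounded, conditionally
centred random variable. -/
lemma condExp_exp_mul_le {Ω : Type*} {m m0 : MeasurableSpace Ω} {μ : Measure Ω}
    [IsProbabilityMeasure μ] (hm : m ≤ m0) {X : Ω → ℝ} {M θ : ℝ}
    (hX : AEStronglyMeasurable X μ) (hcond : μ[X | m] =ᵐ[μ] 0)
    (hbdd : ∀ᵐ ω ∂μ, |X ω| ≤ M) (hθ : 0 ≤ θ) (hθM : θ * M < 3) :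
    μ[fun ω => Real.exp (θ * X ω) | m] ≤ᵐ[μ] fun ω =>
      Real.exp (θ ^ 2 / (2 * (1 - θ * M / 3)) * (μ[fun ω' => X ω' ^ 2 | m]) ω) := by
  set c := θ ^ 2 / (2 * (1 - θ * M / 3)) with hc
  have hXint : Integrable X μ := .of_bound hX M hbdd
  have hX2int : Integrable (fun ω => X ω ^ 2) μ := by
    refine .of_bound (hX.pow 2) (M ^ 2) ?_
    filter_upwards [hbdd] with ω hω
    rw [Real.norm_eq_abs, abs_pow]
    gcongr
  have hexpint : Integrable (fun ω => Real.exp (θ * X ω)) μ :=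
    integrable_exp_mul_of_ae_abs_le hX hbdd hθ
  have hlin : Integrable ((fun _ => (1 : ℝ)) + θ • X) μ :=
    (integrable_const 1).add (hXint.smul θ)
  have hquad : Integrable (c • fun ω => X ω ^ 2) μ := hX2int.smul c
  have hle : (fun ω => Real.exp (θ * X ω)) ≤ᵐ[μ]
      ((fun _ => (1 : ℝ)) + θ • X) + c • fun ω => X ω ^ 2 := by
    filter_upwards [hbdd] with ω hω
    have h := exp_le_one_add_add_sq_div (y := θ * X ω) hθM (by
      rw [abs_mul, abs_of_nonneg hθ]
      gcongr)
    simp only [Pi.add_apply, Pi.smul_apply, smul_eq_mul, hc]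
    convert h using 2
    ring
  filter_upwards [condExp_mono hexpint (hlin.add hquad) hle, condExp_add hlin hquad m,
    condExp_add (integrable_const (1 : ℝ)) (hXint.smul θ) m, condExp_smul θ X m,
    condExp_smul c (fun ω => X ω ^ 2) m, hcond] with ω h1 h2 h3 h4 h5 h6
  simp only [Pi.add_apply, Pi.smul_apply, smul_eq_mul, Pi.zero_apply, condExp_const hm] at *
  rw [h2, h3, h4, h5, h6] at h1
  linarith [Real.add_one_le_exp (c * (μ[fun ω' => X ω' ^ 2 | m]) ω)]

lemma mul_measureReal_inter_add_setIntegral_diff_le {Ω : Type*} {m0 : MeasurableSpace Ω}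
    {μ : Measure Ω} [IsFiniteMeasure μ] {g : Ω → ℝ} (hg : Integrable g μ) (a : ℝ) {B : Set Ω}
    (hB : MeasurableSet B) (hga : MeasurableSet {ω | a ≤ g ω}) :
    a * μ.real (B ∩ {ω | a ≤ g ω}) + ∫ ω in B \ {ω | a ≤ g ω}, g ω ∂μ ≤ ∫ ω in B, g ω ∂μ := by
  rw [← integral_inter_add_sdiff (s := B) hga hg.integrableOn]
  gcongr
  exact setIntegral_ge_of_const_le_real (hB.inter hga) (measure_ne_top _ _) (fun _ h => h.2)
    hg.integrableOn

/-- Ville's maximal inequality for a nonnegative supermartingale on a finite horizon. -/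
lemma mul_measureReal_exists_le_le_integral {Ω : Type*} {m0 : MeasurableSpace Ω}
    {μ : Measure Ω} [IsFiniteMeasure μ] {ℱ : Filtration ℕ m0} {n : ℕ} {Z : ℕ → Ω → ℝ}
    (hZ : ∀ t ≤ n, StronglyMeasurable[ℱ t] (Z t)) (hint : ∀ t ≤ n, Integrable (Z t) μ)
    (hnonneg : ∀ ω, 0 ≤ Z n ω) (hstep : ∀ t < n, μ[Z (t + 1) | ℱ t] ≤ᵐ[μ] Z t) (a : ℝ) :
    a * μ.real {ω | ∃ t ≤ n, a ≤ Z t ω} ≤ ∫ ω, Z 0 ω ∂μ := by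
  have hlevel : ∀ t ≤ n, MeasurableSet[ℱ t] {ω | a ≤ Z t ω} := fun t ht =>
    stronglyMeasurable_const.measurableSet_le (hZ t ht)
  have hhit : ∀ t ≤ n, MeasurableSet[ℱ t] {ω | ∃ s ≤ t, a ≤ Z s ω} := by
    intro t ht
    have : {ω | ∃ s ≤ t, a ≤ Z s ω} = ⋃ s ∈ Set.Iic t, {ω | a ≤ Z s ω} := by
      ext ω
      simp
    rw [this]
    exact MeasurableSet.biUnion (Set.to_countable _) fun s hs =>
      ℱ.mono hs _ (hlevel s (le_trans hs ht))
  have key : ∀ t ≤ n, a * μ.real {ω | ∃ s ≤ t, a ≤ Z s ω}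
      + ∫ ω in {ω | ∃ s ≤ t, a ≤ Z s ω}ᶜ, Z t ω ∂μ ≤ ∫ ω, Z 0 ω ∂μ := by
    intro t
    induction t with
    | zero =>
      intro ht
      have h := mul_measureReal_inter_add_setIntegral_diff_le (hint 0 ht) a MeasurableSet.univ
        (ℱ.le 0 _ (hlevel 0 ht))
      simpa [Set.compl_eq_univ_sdiff] using h
    | succ t ih =>
      intro ht
      have ht' : t ≤ n := by omega
      set A := {ω | ∃ s ≤ t, a ≤ Z s ω} with hA
      set L := {ω | a ≤ Z (t + 1) ω} with hL
      have hAmeas : MeasurableSet[ℱ t] A := hhit t ht'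
      have hLmeas : MeasurableSet L := ℱ.le _ _ (hlevel (t + 1) ht)
      have hsucc : {ω | ∃ s ≤ t + 1, a ≤ Z s ω} = A ∪ Aᶜ ∩ L := by
        ext ω
        simp only [hA, hL, Set.mem_ofPred_eq, Set.mem_union, Set.mem_inter_iff, Set.mem_compl_iff,
          Nat.le_add_one_iff, or_and_right, exists_or, exists_eq_left]
        generalize (∃ s ≤ t, a ≤ Z s ω) = p
        tauto
      have hcompl : (A ∪ Aᶜ ∩ L)ᶜ = Aᶜ \ L := by
        ext ω
        simp only [Set.mem_compl_iff, Set.mem_union, Set.mem_inter_iff, Set.mem_sdiff]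
        tauto
      have hdisj : Disjoint A (Aᶜ ∩ L) :=
        disjoint_compl_right.mono_right Set.inter_subset_left
      have hdescent : ∫ ω in Aᶜ, Z (t + 1) ω ∂μ ≤ ∫ ω in Aᶜ, Z t ω ∂μ := by
        rw [← setIntegral_condExp (ℱ.le t) (hint (t + 1) ht) hAmeas.compl]
        exact setIntegral_mono_ae integrable_condExp.integrableOn (hint t ht').integrableOn
          (hstep t ht)
      have hA0 : MeasurableSet A := ℱ.le t _ hAmeas
      have h := mul_measureReal_inter_add_setIntegral_diff_le (hint (t + 1) ht) a hA0.compl hLmeas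
      rw [hsucc, hcompl, measureReal_union hdisj (hA0.compl.inter hLmeas), mul_add]
      linarith [ih ht']
  have h := key n le_rfl
  have : 0 ≤ ∫ ω in {ω | ∃ s ≤ n, a ≤ Z s ω}ᶜ, Z n ω ∂μ := integral_nonneg hnonneg
  linarith

/-- The one-sided form of Freedman's inequality. -/
lemma measureReal_exists_le_sum_le {Ω : Type*} {m0 : MeasurableSpace Ω}
    (μ : Measure Ω) [IsProbabilityMeasure μ] (ℱ : Filtration ℕ m0)
    (n : ℕ) (X : ℕ → Ω → ℝ) (M : ℝ) (hM : 0 < M)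
    (hadapted : ∀ t, 1 ≤ t → t ≤ n → StronglyMeasurable[ℱ t] (X t))
    (hcond : ∀ t, 1 ≤ t → t ≤ n → μ[X t | ℱ (t - 1)] =ᵐ[μ] 0)
    (hbdd : ∀ t, 1 ≤ t → t ≤ n → ∀ᵐ ω ∂μ, |X t ω| ≤ M)
    (ℓ : ℝ) (hℓ : 0 ≤ ℓ) (σ2 : ℝ) (hσ : 0 < σ2) :
    μ.real {ω | ∃ t ≤ n, ℓ ≤ ∑ j ∈ Finset.Icc 1 t, X j ω ∧
        ∑ j ∈ Finset.Icc 1 t, (μ[fun ω' => (X j ω') ^ 2 | ℱ (j - 1)]) ω ≤ σ2}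
      ≤ Real.exp (-(ℓ ^ 2 / 2) / (σ2 + M * ℓ / 3)) := by
  set D := σ2 + M * ℓ / 3 with hD
  have hDpos : 0 < D := by positivity
  set θ := ℓ / D with hθ
  have hθ0 : 0 ≤ θ := by positivity
  have hslack : 1 - θ * M / 3 = σ2 / D := by
    rw [hθ]
    field_simp
    rw [hD]
    ring
  have hθM : θ * M < 3 := by
    have : 0 < σ2 / D := by positivity
    linarith
  set c := θ ^ 2 / (2 * (1 - θ * M / 3)) with hc
  have hc0 : 0 ≤ c := by
    rw [hc, hslack]
    positivity
  have hexponent : θ * ℓ - c * σ2 = ℓ ^ 2 / 2 / D := by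
    rw [hc, hslack, hθ]
    field_simp
    ring
  let V : ℕ → Ω → ℝ := fun j => μ[fun ω' => (X j ω') ^ 2 | ℱ (j - 1)]
  let Z : ℕ → Ω → ℝ := fun t ω =>
    Real.exp (θ * ∑ j ∈ Finset.Icc 1 t, X j ω - c * ∑ j ∈ Finset.Icc 1 t, V j ω)
  have hVnonneg : ∀ j, 0 ≤ᵐ[μ] V j := fun j =>
    condExp_nonneg (.of_forall fun ω => sq_nonneg (X j ω))
  have hVmeas : ∀ j, StronglyMeasurable[ℱ (j - 1)] (V j) := fun j => stronglyMeasurable_condExp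
  have hsummeas : ∀ t ≤ n, StronglyMeasurable[ℱ t]
      (fun ω => θ * ∑ j ∈ Finset.Icc 1 t, X j ω - c * ∑ j ∈ Finset.Icc 1 t, V j ω) := by
    intro t ht
    refine (StronglyMeasurable.const_mul (Finset.stronglyMeasurable_fun_sum _ fun j hj => ?_) θ).sub
      (StronglyMeasurable.const_mul (Finset.stronglyMeasurable_fun_sum _ fun j hj => ?_) c)
    · rw [Finset.mem_Icc] at hj
      exact (hadapted j hj.1 (hj.2.trans ht)).mono (ℱ.mono hj.2)
    · rw [Finset.mem_Icc] at hj
      exact (hVmeas j).mono (ℱ.mono (by omega))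
  have hZmeas : ∀ t ≤ n, StronglyMeasurable[ℱ t] (Z t) := fun t ht =>
    Real.continuous_exp.comp_stronglyMeasurable (hsummeas t ht)
  have hZbdd : ∀ t ≤ n, ∀ᵐ ω ∂μ, ‖Z t ω‖ ≤ Real.exp (θ * (t * M)) := by
    intro t ht
    have hX : ∀ᵐ ω ∂μ, ∀ j ∈ Finset.Icc 1 t, |X j ω| ≤ M := by
      refine (Finset.eventually_all _).2 fun j hj => ?_
      rw [Finset.mem_Icc] at hj
      exact hbdd j hj.1 (hj.2.trans ht)
    filter_upwards [hX, ae_all_iff.2 hVnonneg] with ω hω hV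
    have hS : ∑ j ∈ Finset.Icc 1 t, X j ω ≤ t * M := by
      simpa using Finset.sum_le_card_nsmul _ _ M fun j hj => (le_abs_self _).trans (hω j hj)
    have hW : 0 ≤ c * ∑ j ∈ Finset.Icc 1 t, V j ω :=
      mul_nonneg hc0 (Finset.sum_nonneg fun j _ => hV j)
    rw [Real.norm_eq_abs, Real.abs_exp]
    gcongr
    exact (sub_le_self _ hW).trans (by gcongr)
  have hZint : ∀ t ≤ n, Integrable (Z t) μ := fun t ht =>
    .of_bound ((hZmeas t ht).mono (ℱ.le t)).aestronglyMeasurable _ (hZbdd t ht)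
  have hstep : ∀ t < n, μ[Z (t + 1) | ℱ t] ≤ᵐ[μ] Z t := by
    intro t ht
    have hXmeas : AEStronglyMeasurable (X (t + 1)) μ :=
      ((hadapted (t + 1) (by omega) ht).mono (ℱ.le _)).aestronglyMeasurable
    have hXb := hbdd (t + 1) (by omega) ht
    have hexpint : Integrable (fun ω => Real.exp (θ * X (t + 1) ω)) μ :=
      integrable_exp_mul_of_ae_abs_le hXmeas hXb hθ0
    let U : Ω → ℝ := fun ω => Z t ω * Real.exp (-(c * V (t + 1) ω))
    have hUmeas : StronglyMeasurable[ℱ t] U :=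
      (hZmeas t ht.le).mul (Real.continuous_exp.comp_stronglyMeasurable
        ((hVmeas (t + 1)).const_mul c).neg)
    have hfactor : Z (t + 1) = U * fun ω => Real.exp (θ * X (t + 1) ω) := by
      ext ω
      simp only [Z, U, Pi.mul_apply, ← Real.exp_add]
      rw [Finset.sum_Icc_succ_top (by omega), Finset.sum_Icc_succ_top (by omega)]
      congr 1
      ring
    have hpull : μ[Z (t + 1) | ℱ t] =ᵐ[μ] U * μ[fun ω => Real.exp (θ * X (t + 1) ω) | ℱ t] := by
      have hint := hZint (t + 1) ht
      rw [hfactor] at hint ⊢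
      exact condExp_mul_of_stronglyMeasurable_left hUmeas hint hexpint
    filter_upwards [hpull, condExp_exp_mul_le (ℱ.le t) hXmeas (hcond (t + 1) (by omega) ht) hXb
      hθ0 hθM] with ω h1 h2
    rw [h1, Pi.mul_apply]
    calc U ω * (μ[fun ω => Real.exp (θ * X (t + 1) ω) | ℱ t]) ω
        ≤ U ω * Real.exp (c * V (t + 1) ω) :=
          mul_le_mul_of_nonneg_left h2 (by positivity)
      _ = Z t ω := by
          simp only [U, mul_assoc, ← Real.exp_add, neg_add_cancel, Real.exp_zero, mul_one]
  have hville := mul_measureReal_exists_le_le_integral hZmeas hZint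
    (fun ω => (Real.exp_pos _).le) hstep (Real.exp (ℓ ^ 2 / 2 / D))
  have hZ0 : ∫ ω, Z 0 ω ∂μ = 1 := by simp [Z]
  rw [hZ0, mul_comm, ← le_div_iff₀ (Real.exp_pos _), one_div, ← Real.exp_neg, ← neg_div] at hville
  refine le_trans (measureReal_mono ?_) hville
  rintro ω ⟨t, ht, hS, hW⟩
  refine ⟨t, ht, Real.exp_le_exp.2 ?_⟩
  rw [← hexponent]
  exact sub_le_sub (mul_le_mul_of_nonneg_left hS hθ0) (mul_le_mul_of_nonneg_left hW hc0)

theorem freedman_inequality {Ω : Type*} {m0 : MeasurableSpace Ω}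
    (μ : Measure Ω) [IsProbabilityMeasure μ] (ℱ : Filtration ℕ m0)
    (n : ℕ) (X : ℕ → Ω → ℝ) (M : ℝ) (hM : 0 < M)
    (hadapted : ∀ t, 1 ≤ t → t ≤ n → StronglyMeasurable[ℱ t] (X t))
    (hcond : ∀ t, 1 ≤ t → t ≤ n → μ[X t | ℱ (t - 1)] =ᵐ[μ] 0)
    (hbdd : ∀ t, 1 ≤ t → t ≤ n → ∀ᵐ ω ∂μ, |X t ω| ≤ M)
    (ℓ : ℝ) (hℓ : 0 ≤ ℓ) (σ2 : ℝ) (hσ : 0 < σ2) :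
    μ {ω | ∃ t ≤ n, ℓ ≤ |∑ j ∈ Finset.Icc 1 t, X j ω| ∧
        ∑ j ∈ Finset.Icc 1 t, (μ[fun ω' => (X j ω') ^ 2 | ℱ (j - 1)]) ω ≤ σ2}
      ≤ ENNReal.ofReal (2 * Real.exp (-(ℓ ^ 2 / 2) / (σ2 + M * ℓ / 3))) := by
  have hupper := measureReal_exists_le_sum_le μ ℱ n X M hM hadapted hcond hbdd ℓ hℓ σ2 hσ
  have hlower := measureReal_exists_le_sum_le μ ℱ n (fun t => -X t) M hM
    (fun t h1 hn => (hadapted t h1 hn).neg)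
    (fun t h1 hn => by
      filter_upwards [condExp_neg (μ := μ) (X t) (ℱ (t - 1)), hcond t h1 hn] with ω h h'
      simp [h, h'])
    (fun t h1 hn => by simpa using hbdd t h1 hn) ℓ hℓ σ2 hσ
  simp only [Pi.neg_apply, neg_sq, Finset.sum_neg_distrib] at hlower
  rw [← ofReal_measureReal]
  refine ENNReal.ofReal_le_ofReal ?_
  rw [two_mul]
  refine (measureReal_mono ?_).trans ((measureReal_union_le _ _).trans (add_le_add hupper hlower))
  rintro ω ⟨t, ht, hS, hW⟩
  rcases le_abs.1 hS with h | h
  · exact Or.inl ⟨t, ht, h, hW⟩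
  · exact Or.inr ⟨t, ht, h, hW⟩
end
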